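/- Consider the k-user MISO BC with hybrid CSIT where 𝒫 = {1,…,|𝒫|} and 𝒟 = {|𝒫|+1,…,|𝒫|+|𝒟|} with |𝒟| ≥ 1. For every decodable linear coding strategy of block length n, almost surely Σ_{j=1}^{|𝒫|+|𝒟|−1} m_j(n)/2^j ≤ rank[ G_{|𝒫|+|𝒟|}^n [V_1^n … V_{|𝒫|+|𝒟|−1}^n] ], where [V_1^n … V_{|𝒫|+|𝒟|−1}^n] denotes horizontal concatenation. -/

import Mathlib

open MeasureTheory Matrix Filter Topology

noncomputable section

/-- CSIT state of a receiver: instantaneous (`P`), delayed (`D`), or none (`N`). -/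
inductive CSITState : Type
  | P : CSITState
  | D : CSITState
  | N : CSITState
  deriving DecidableEq

/-- A channel realization: for each receiver `j`, time slot `t` and transmit antenna `a`,
the channel coefficient `g j t a`. -/
abbrev Chan (k m n : ℕ) : Type := Fin k → Fin n → Fin m → ℂ

/-- Joint law of the channel coefficients: all entries i.i.d. with common law `μ`. -/
def chanMeasure (k m n : ℕ) (μ : Measure ℂ) : Measure (Chan k m n) :=
  Measure.pi fun _ : Fin k => Measure.pi fun _ : Fin n => Measure.pi fun _ : Fin m => μ

/-- The block-diagonal channel matrix `G_j^n ∈ ℂ^{n × nm}` of a receiver with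
channel vectors `g (t) ∈ ℂ^{1 × m}`. -/
def blockDiag {m n : ℕ} (g : Fin n → Fin m → ℂ) : Matrix (Fin n) (Fin n × Fin m) ℂ :=
  Matrix.of fun t p => if p.1 = t then g t p.2 else 0

/-- A linear coding strategy of block length `n` for the `k`-user MISO BC with `m`
transmit antennas and hybrid CSIT configuration `I`. -/
structure Strategy (k m n : ℕ) (I : Fin k → CSITState) : Type where
  /-- number of information symbols `m_j(n)` for receiver `j` -/
  dim : Fin k → ℕ
  /-- precoding matrix `V_j(t) ∈ ℂ^{m × m_j(n)}`, a function of the channel realization -/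
  pre : (j : Fin k) → Fin n → Chan k m n → Matrix (Fin m) (Fin (dim j)) ℂ
  /-- each precoder is a measurable function of the channels -/
  meas : ∀ j t a c, Measurable fun g => pre j t g a c
  /-- `V_j(t)` depends only on the CSIT available at time `t`: current and past channels of
  receivers with instantaneous CSIT, and strictly past channels of receivers with delayed
  CSIT (and nothing from receivers with no CSIT). -/
  causal : ∀ (j : Fin k) (t : Fin n) (g g' : Chan k m n),
    (∀ i, I i = CSITState.P → ∀ s : Fin n, (s : ℕ) ≤ (t : ℕ) → g i s = g' i s) →
    (∀ i, I i = CSITState.D → ∀ s : Fin n, (s : ℕ) < (t : ℕ) → g i s = g' i s) →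
    pre j t g = pre j t g'

namespace Strategy

variable {k m n : ℕ} {I : Fin k → CSITState}

/-- The overall precoding matrix `V_j^n ∈ ℂ^{nm × m_j(n)}` (vertical concatenation of the
`V_j(t)`). -/
def Vn (f : Strategy k m n I) (j : Fin k) (g : Chan k m n) :
    Matrix (Fin n × Fin m) (Fin (f.dim j)) ℂ :=
  Matrix.of fun r c => f.pre j r.1 g r.2 c

/-- Horizontal concatenation `[∪_{i ∈ S} V_i^n]` of the precoding matrices of the
receivers in `S`. -/
def VS (f : Strategy k m n I) (S : Finset (Fin k)) (g : Chan k m n) :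
    Matrix (Fin n × Fin m) ((i : {x // x ∈ S}) × Fin (f.dim i.1)) ℂ :=
  Matrix.of fun r c => f.Vn c.1.1 g r c.2

/-- The received-signal matrix `G_j^n [∪_{i ∈ S} V_i^n]` at receiver `j`. -/
def recvS (f : Strategy k m n I) (S : Finset (Fin k)) (j : Fin k) (g : Chan k m n) :
    Matrix (Fin n) ((i : {x // x ∈ S}) × Fin (f.dim i.1)) ℂ :=
  blockDiag (g j) * f.VS S g

/-- The received-signal matrix `G_j^n V_j^n` at receiver `j` from its own precoder. -/
def recv1 (f : Strategy k m n I) (j : Fin k) (g : Chan k m n) :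
    Matrix (Fin n) (Fin (f.dim j)) ℂ :=
  blockDiag (g j) * f.Vn j g

/-- `G_j^t [∪_{i ∈ S} V_i^t]`: the received signal matrix restricted to the first `t`
time slots (rows beyond `t` set to zero, so that its rank is that of the truncated
matrix, with the `t = 0` convention of rank `0`). -/
def recvUpTo (f : Strategy k m n I) (S : Finset (Fin k)) (j : Fin k)
    (g : Chan k m n) (t : ℕ) :
    Matrix (Fin n) ((i : {x // x ∈ S}) × Fin (f.dim i.1)) ℂ :=
  Matrix.of fun s c => if (s : ℕ) < t then f.recvS S j g s c else 0

/-- Decodability: for every receiver `j`, almost surely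
`rank[G_j^n[∪_i V_i^n]] − rank[G_j^n[∪_{i ≠ j} V_i^n]] = rank[G_j^n V_j^n] = m_j(n)`. -/
def Decodable (f : Strategy k m n I) (μ : Measure ℂ) : Prop :=
  ∀ j : Fin k, ∀ᵐ g ∂ chanMeasure k m n μ,
    (f.recvS Finset.univ j g).rank - (f.recvS (Finset.univ.erase j) j g).rank
        = (f.recv1 j g).rank ∧
    (f.recv1 j g).rank = f.dim j

end Strategy

/-- A DoF tuple is linearly achievable if there is a sequence of decodable strategies
achieving it in the limit. -/
def LinAchievable (k m : ℕ) (I : Fin k → CSITState) (μ : Measure ℂ) (d : Fin k → ℝ) : Prop :=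
  (∀ j, 0 ≤ d j ∧ d j ≤ 1) ∧
  ∃ F : (n : ℕ) → Strategy k m n I,
    (∀ n, (F n).Decodable μ) ∧
    ∀ j, Tendsto (fun n : ℕ => ((F n).dim j : ℝ) / n) atTop (nhds (d j))

/-- The linear degrees-of-freedom region: closure of the set of linearly achievable tuples. -/
def LDoFRegion (k m : ℕ) (I : Fin k → CSITState) (μ : Measure ℂ) : Set (Fin k → ℝ) :=
  closure {d | LinAchievable k m I μ d}

/-- The linear sum degrees of freedom. -/
def LDoFSum (k m : ℕ) (I : Fin k → CSITState) (μ : Measure ℂ) : ℝ :=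
  sSup ((fun d => ∑ j, d j) '' LDoFRegion k m I μ)

/-- The set `𝒫` of receivers supplying instantaneous CSIT. -/
def stateP (k : ℕ) (I : Fin k → CSITState) : Finset (Fin k) :=
  Finset.univ.filter fun i => I i = CSITState.P

/-- The set `𝒟` of receivers supplying delayed CSIT. -/
def stateD (k : ℕ) (I : Fin k → CSITState) : Finset (Fin k) :=
  Finset.univ.filter fun i => I i = CSITState.D

/-- The set `𝒩` of receivers supplying no CSIT. -/
def stateN (k : ℕ) (I : Fin k → CSITState) : Finset (Fin k) :=
  Finset.univ.filter fun i => I i = CSITState.N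

lemma measurableSet_mem_span_range {X ι κ : Type*} [MeasurableSpace X] [Fintype ι] [Fintype κ]
    (w : ι → X → κ → ℂ) (v : X → κ → ℂ) (hw : ∀ i, Measurable (w i)) (hv : Measurable v) :
    MeasurableSet {x | v x ∈ Submodule.span ℂ (Set.range fun i => w i x)} := by
  have key : {q : (ι → κ → ℂ) × (κ → ℂ) | q.2 ∈ Submodule.span ℂ (Set.range q.1)} =
      ⋂ N : ℕ, ⋃ c : ι → ℂ, {q | ‖q.2 - ∑ i, c i • q.1 i‖ < 1 / ((N : ℝ) + 1)} := by
    ext ⟨a, b⟩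
    simp only [Set.mem_ofPred_eq, Set.mem_iInter, Set.mem_iUnion]
    constructor
    · intro h N
      obtain ⟨c, rfl⟩ := (Submodule.mem_span_range_iff_exists_fun ℂ).1 h
      exact ⟨c, by simp; positivity⟩
    · intro h
      have hc := (Submodule.span ℂ (Set.range a)).closed_of_finiteDimensional
      rw [← SetLike.mem_coe, ← hc.closure_eq, Metric.mem_closure_iff]
      intro ε hε
      obtain ⟨N, hN⟩ := exists_nat_one_div_lt hε
      obtain ⟨c, hc⟩ := h N
      refine ⟨_, (Submodule.mem_span_range_iff_exists_fun ℂ).2 ⟨c, rfl⟩, ?_⟩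
      rw [dist_eq_norm]
      exact hc.trans hN
  have hm : MeasurableSet
      {q : (ι → κ → ℂ) × (κ → ℂ) | q.2 ∈ Submodule.span ℂ (Set.range q.1)} := by
    rw [key]
    refine MeasurableSet.iInter fun N => IsOpen.measurableSet (isOpen_iUnion fun c => ?_)
    exact isOpen_lt (by fun_prop) continuous_const
  exact hm.preimage ((measurable_pi_lambda _ hw).prodMk hv)

lemma pi_eq_zero_of_forall_update {ι : Type*} [Fintype ι] [DecidableEq ι] {α : ι → Type*}
    [∀ i, MeasurableSpace (α i)] (ν : ∀ i, Measure (α i)) [∀ i, SigmaFinite (ν i)]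
    {B : Set (∀ i, α i)} (hB : MeasurableSet B) (i : ι)
    (h : ∀ x, ν i {y | Function.update x i y ∈ B} = 0) : Measure.pi ν B = 0 := by
  rw [← lintegral_indicator_one hB]
  have hm : Measurable (B.indicator (1 : (∀ i, α i) → ENNReal)) := measurable_one.indicator hB
  rcases isEmpty_or_nonempty (∀ i, α i) with he | ⟨⟨x₀⟩⟩
  · have : B = ∅ := Set.eq_empty_of_isEmpty B
    simp [this]
  rw [lintegral_eq_lmarginal_univ x₀, lmarginal_erase' _ hm (Finset.mem_univ i)]
  have h0 : (fun x => ∫⁻ y, B.indicator (1 : (∀ i, α i) → ENNReal) (Function.update x i y) ∂ν i)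
      = fun _ => 0 := by
    funext x
    have hx : MeasurableSet {y | Function.update x i y ∈ B} := hB.preimage (measurable_update x)
    rw [← h x, ← lintegral_indicator_one hx]
    rfl
  rw [h0]
  simp [lmarginal]

lemma pi_submodule_eq_zero {κ : Type*} [Fintype κ] [DecidableEq κ] (μ : Measure ℂ)
    [SigmaFinite μ] [NullSingletonClass μ] (U : Submodule ℂ (κ → ℂ)) (a : κ) (ha : Pi.single a 1 ∉ U) :
    Measure.pi (fun _ : κ => μ) (U : Set (κ → ℂ)) = 0 := by
  refine pi_eq_zero_of_forall_update _ U.closed_of_finiteDimensional.measurableSet a fun x => ?_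
  refine Set.Subsingleton.measure_zero (fun y hy z hz => ?_) μ
  by_contra hne
  apply ha
  have h := U.smul_mem (y - z)⁻¹ (U.sub_mem hy hz)
  convert h using 1
  ext b
  have : y - z ≠ 0 := sub_ne_zero.2 hne
  rcases eq_or_ne b a with rfl | hb
  · simp [this]
  · simp [hb]

lemma finrank_span_sup_span_le_two_mul {n : ℕ} {E : Type*} [AddCommGroup E] [Module ℂ E]
    [FiniteDimensional ℂ E] (A B : Fin n → E)
    (h : ∀ t, B t ∈ Submodule.span ℂ (Set.range fun s : {s // s < t} => B s) →
      A t ∈ Submodule.span ℂ (Set.range fun s : {s // s < t} => B s)) :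
    Module.finrank ℂ ↥(Submodule.span ℂ (Set.range A) ⊔ Submodule.span ℂ (Set.range B)) ≤
      2 * Module.finrank ℂ (Submodule.span ℂ (Set.range B)) := by
  let W : ℕ → Submodule ℂ E := fun q => Submodule.span ℂ (B '' {s | (s : ℕ) < q})
  let U : ℕ → Submodule ℂ E := fun q => Submodule.span ℂ (A '' {s | (s : ℕ) < q}) ⊔ W q
  have hset : ∀ q (hq : q < n), {s : Fin n | (s : ℕ) < q + 1} =
      insert ⟨q, hq⟩ {s : Fin n | (s : ℕ) < q} := by
    intro q hq
    ext s
    simp only [Set.mem_ofPred_eq, Set.mem_insert_iff, Fin.ext_iff]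
    omega
  have key : ∀ q ≤ n, Module.finrank ℂ (U q) ≤ 2 * Module.finrank ℂ (W q) := by
    intro q
    induction q with
    | zero =>
      have h0 : U 0 = ⊥ := by simp [U, W]
      rw [h0, finrank_bot]
      intro _
      exact Nat.zero_le _
    | succ q ih =>
      intro hq
      have ih := ih (by omega)
      have hW : W (q + 1) = Submodule.span ℂ {B ⟨q, hq⟩} ⊔ W q := by
        simp only [W, hset q hq, Set.image_insert_eq, Submodule.span_insert]
      have hU : U (q + 1) =
          Submodule.span ℂ {A ⟨q, hq⟩} ⊔ (Submodule.span ℂ {B ⟨q, hq⟩} ⊔ U q) := by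
        simp only [U, hW]
        simp only [hset q hq, Set.image_insert_eq, Submodule.span_insert]
        ac_rfl
      have hWq : W q = Submodule.span ℂ (Set.range fun s : {s // s < (⟨q, hq⟩ : Fin n)} => B s) := by
        simp only [W]
        congr 1
        ext v
        simp [Fin.lt_def]
      by_cases hb : B ⟨q, hq⟩ ∈ W q
      · have ha : A ⟨q, hq⟩ ∈ W q := by
          rw [hWq] at hb ⊢
          exact h _ hb
        have hle : W q ≤ U q := le_sup_right
        have e1 : W (q + 1) = W q := by
          rw [hW]
          simpa using hb
        have e2 : U (q + 1) = U q := by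
          rw [hU]
          simp [hle hb, hle ha]
        rw [e1, e2]
        exact ih
      · have h1 : Module.finrank ℂ (W q) < Module.finrank ℂ (W (q + 1)) := by
          apply Submodule.finrank_lt_finrank_of_lt
          rw [hW]
          refine lt_of_le_of_ne le_sup_right fun he => hb ?_
          rw [he]
          exact Submodule.mem_sup_left (Submodule.mem_span_singleton_self _)
        have h2 := Submodule.finrank_add_le_finrank_add_finrank
          (Submodule.span ℂ {A ⟨q, hq⟩}) (Submodule.span ℂ {B ⟨q, hq⟩} ⊔ U q)
        have h3 := Submodule.finrank_add_le_finrank_add_finrank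
          (Submodule.span ℂ {B ⟨q, hq⟩}) (U q)
        have h4 := finrank_span_le_card (R := ℂ) ({A ⟨q, hq⟩} : Set E)
        have h5 := finrank_span_le_card (R := ℂ) ({B ⟨q, hq⟩} : Set E)
        simp only [Set.toFinset_singleton, Finset.card_singleton] at h4 h5
        rw [hU]
        omega
  have hn := key n le_rfl
  have huniv : {s : Fin n | (s : ℕ) < n} = Set.univ := by
    ext s
    simp
  have hWn : W n = Submodule.span ℂ (Set.range B) := by simp only [W, huniv, Set.image_univ]
  have hUn : U n = Submodule.span ℂ (Set.range A) ⊔ Submodule.span ℂ (Set.range B) := by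
    simp only [U, hWn, huniv, Set.image_univ]
  rwa [hUn, hWn] at hn

lemma rank_fromRows_le_two_mul {n : ℕ} {κ : Type*} [Fintype κ] (A B : Matrix (Fin n) κ ℂ)
    (h : ∀ t, B t ∈ Submodule.span ℂ (Set.range fun s : {s // s < t} => B s) →
      A t ∈ Submodule.span ℂ (Set.range fun s : {s // s < t} => B s)) :
    (Matrix.fromRows A B).rank ≤ 2 * B.rank := by
  have hr : Set.range (Matrix.fromRows A B).row = Set.range A.row ∪ Set.range B.row := by
    ext v
    simp only [Set.mem_range, Set.mem_union, Sum.exists]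
    rfl
  rw [Matrix.rank_eq_finrank_span_row, Matrix.rank_eq_finrank_span_row, hr, Submodule.span_union]
  exact finrank_span_sup_span_le_two_mul A.row B.row h

lemma add_finrank_map_le {E F F' G : Type*} [AddCommGroup E] [Module ℂ E] [AddCommGroup F]
    [Module ℂ F] [AddCommGroup F'] [Module ℂ F'] [AddCommGroup G] [Module ℂ G]
    [FiniteDimensional ℂ E] [FiniteDimensional ℂ G] [FiniteDimensional ℂ F]
    [FiniteDimensional ℂ F']
    (H : E →ₗ[ℂ] G) (pA : G →ₗ[ℂ] F) (pB : G →ₗ[ℂ] F') (X X' Y : Submodule ℂ E) (hX : X ≤ X')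
    (d : ℕ)
    (h1 : Module.finrank ℂ ((X' ⊔ Y).map (pA ∘ₗ H)) - Module.finrank ℂ (X'.map (pA ∘ₗ H)) = d)
    (h2 : Module.finrank ℂ (Y.map (pA ∘ₗ H)) = d) (h3 : Module.finrank ℂ Y ≤ d) :
    d + Module.finrank ℂ (X.map (pB ∘ₗ H)) ≤ Module.finrank ℂ ((X ⊔ Y).map H) := by
  have hinf : X'.map (pA ∘ₗ H) ⊓ Y.map (pA ∘ₗ H) = ⊥ := by
    rw [← Submodule.finrank_eq_zero (R := ℂ)]
    have h := Submodule.finrank_sup_add_finrank_inf_eq (X'.map (pA ∘ₗ H)) (Y.map (pA ∘ₗ H))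
    have h' := Submodule.finrank_mono
      (inf_le_right : X'.map (pA ∘ₗ H) ⊓ Y.map (pA ∘ₗ H) ≤ Y.map (pA ∘ₗ H))
    rw [Submodule.map_sup] at h1
    omega
  have hinj : ∀ y ∈ Y, pA (H y) = 0 → y = 0 := by
    have h := LinearMap.finrank_range_add_finrank_ker ((pA ∘ₗ H).domRestrict Y)
    rw [LinearMap.range_domRestrict] at h
    have hk : LinearMap.ker ((pA ∘ₗ H).domRestrict Y) = ⊥ := by
      rw [← Submodule.finrank_eq_zero (R := ℂ)]
      omega
    intro y hy h0
    have := (LinearMap.ker_eq_bot'.1 hk) ⟨y, hy⟩ h0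
    simpa using this
  have hdisj : X.map H ⊓ Y.map H = ⊥ := by
    rw [eq_bot_iff]
    rintro z ⟨⟨x, hx, rfl⟩, ⟨y, hy, hxy⟩⟩
    have hm : pA (H y) ∈ X'.map (pA ∘ₗ H) ⊓ Y.map (pA ∘ₗ H) :=
      ⟨⟨x, hX hx, by simp [hxy]⟩, ⟨y, hy, rfl⟩⟩
    rw [hinf, Submodule.mem_bot] at hm
    rw [← hxy, hinj y hy hm]
    simp
  have hs := Submodule.finrank_sup_add_finrank_inf_eq (X.map H) (Y.map H)
  rw [hdisj, finrank_bot, ← Submodule.map_sup] at hs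
  have hA := Submodule.finrank_map_le pA (Y.map H)
  have hB := Submodule.finrank_map_le pB (X.map H)
  rw [← Submodule.map_comp] at hA hB
  omega

namespace Strategy

variable {k m n : ℕ} {I : Fin k → CSITState}

lemma range_VS (f : Strategy k m n I) (S : Finset (Fin k)) (g : Chan k m n) :
    LinearMap.range (f.VS S g).mulVecLin = ⨆ i ∈ S, LinearMap.range (f.Vn i g).mulVecLin := by
  simp only [Matrix.range_mulVecLin, ← Submodule.span_iUnion]
  congr 1
  ext v
  simp only [Set.mem_range, Set.mem_iUnion]
  constructor
  · rintro ⟨⟨⟨i, hi⟩, c⟩, rfl⟩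
    exact ⟨i, hi, c, rfl⟩
  · rintro ⟨i, hi, c, rfl⟩
    exact ⟨⟨⟨i, hi⟩, c⟩, rfl⟩

lemma rank_recvS (f : Strategy k m n I) (S : Finset (Fin k)) (j : Fin k) (g : Chan k m n) :
    (f.recvS S j g).rank = Module.finrank ℂ
      ((⨆ i ∈ S, LinearMap.range (f.Vn i g).mulVecLin).map (blockDiag (g j)).mulVecLin) := by
  rw [← range_VS, ← LinearMap.range_comp, ← Matrix.mulVecLin_mul]
  rfl

lemma recvS_row (f : Strategy k m n I) (S : Finset (Fin k)) (j : Fin k) (g : Chan k m n)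
    (t : Fin n) : f.recvS S j g t = ∑ a, g j t a • f.VS S g (t, a) := by
  ext c
  simp [recvS, Matrix.mul_apply, _root_.blockDiag, Fintype.sum_prod_type]

/-- The span of the rows received by receiver `j` strictly before time `t`. -/
def pastSpan (f : Strategy k m n I) (S : Finset (Fin k)) (j : Fin k) (t : Fin n)
    (g : Chan k m n) : Submodule ℂ (((i : {x // x ∈ S}) × Fin (f.dim i.1)) → ℂ) :=
  Submodule.span ℂ (Set.range fun s : {s // s < t} => f.recvS S j g s)

lemma measurable_VS (f : Strategy k m n I) (S : Finset (Fin k)) (r : Fin n × Fin m) :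
    Measurable fun g => f.VS S g r :=
  measurable_pi_lambda _ fun c => f.meas c.1.1 r.1 r.2 c.2

lemma measurable_recvS (f : Strategy k m n I) (S : Finset (Fin k)) (j : Fin k) (t : Fin n) :
    Measurable fun g => f.recvS S j g t := by
  simp only [recvS_row]
  have := f.measurable_VS S
  fun_prop

lemma ae_forall_VS_mem_pastSpan (f : Strategy k m n I) (μ : Measure ℂ) [IsProbabilityMeasure μ]
    [NullSingletonClass μ] (S : Finset (Fin k)) (j : Fin k) (hj : I j = CSITState.D) (t : Fin n) :
    ∀ᵐ g ∂chanMeasure k m n μ,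
      f.recvS S j g t ∈ f.pastSpan S j t g → ∀ a, f.VS S g (t, a) ∈ f.pastSpan S j t g := by
  suffices H : ∀ a, ∀ᵐ g ∂chanMeasure k m n μ,
      f.recvS S j g t ∈ f.pastSpan S j t g → f.VS S g (t, a) ∈ f.pastSpan S j t g by
    filter_upwards [ae_all_iff.2 H] with g hg h a using hg a h
  intro a
  have hmeas : MeasurableSet {g | ¬ (f.recvS S j g t ∈ f.pastSpan S j t g →
      f.VS S g (t, a) ∈ f.pastSpan S j t g)} := by
    have h1 := measurableSet_mem_span_range (fun s : {s // s < t} => fun g => f.recvS S j g s)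
      (fun g => f.recvS S j g t) (fun s => f.measurable_recvS S j s) (f.measurable_recvS S j t)
    have h2 := measurableSet_mem_span_range (fun s : {s // s < t} => fun g => f.recvS S j g s)
      (fun g => f.VS S g (t, a)) (fun s => f.measurable_recvS S j s) (f.measurable_VS S (t, a))
    exact (h1.imp h2).compl
  rw [ae_iff]
  refine pi_eq_zero_of_forall_update _ hmeas j fun g => ?_
  refine pi_eq_zero_of_forall_update _ (hmeas.preimage (measurable_update g)) t fun x => ?_
  set G : (Fin m → ℂ) → Chan k m n :=
    fun y => Function.update g j (Function.update x t y) with hG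
  have hpre : ∀ y i (s : Fin n), s ≤ t → f.pre i s (G y) = f.pre i s (G 0) := by
    intro y i s hs
    apply f.causal
    · intro l hl s' _
      have : l ≠ j := by
        rintro rfl
        simp [hl] at hj
      simp [hG, this]
    · intro l _ s' hs'
      have : s' ≠ t := by
        rintro rfl
        exact absurd hs (not_le.2 hs')
      rcases eq_or_ne l j with rfl | hl
      · simp [hG, this]
      · simp [hG, hl]
  have hVS : ∀ y (s : Fin n) b, s ≤ t → f.VS S (G y) (s, b) = f.VS S (G 0) (s, b) := by
    intro y s b hs
    ext c
    simp [VS, Vn, hpre y _ s hs]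
  have hpast : ∀ y, f.pastSpan S j t (G y) = f.pastSpan S j t (G 0) := by
    intro y
    unfold pastSpan
    congr 2
    funext s
    rw [recvS_row, recvS_row]
    refine Finset.sum_congr rfl fun b _ => ?_
    rw [hVS y s b s.2.le]
    simp [hG, s.2.ne]
  set φ := Fintype.linearCombination ℂ fun b => f.VS S (G 0) (t, b)
  by_cases ha : f.VS S (G 0) (t, a) ∈ f.pastSpan S j t (G 0)
  · convert measure_empty
    · ext y
      have : f.VS S (G y) (t, a) ∈ f.pastSpan S j t (G y) := by
        rw [hVS y t a le_rfl, hpast y]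
        exact ha
      simpa using fun _ => this
    · infer_instance
  · refine measure_mono_null (fun y hy => ?_)
      (pi_submodule_eq_zero μ ((f.pastSpan S j t (G 0)).comap φ) a ?_)
    · have hy1 : f.recvS S j (G y) t ∈ f.pastSpan S j t (G y) := by
        by_contra hc
        exact hy fun h => absurd h hc
      rw [hpast y, recvS_row] at hy1
      simp only [hVS y t _ le_rfl] at hy1
      simpa [φ, Fintype.linearCombination_apply, hG] using hy1
    · simpa [φ] using ha

lemma ae_rank_fromRows_le (f : Strategy k m n I) (μ : Measure ℂ) [IsProbabilityMeasure μ]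
    [NullSingletonClass μ] (S : Finset (Fin k)) (i j : Fin k) (hj : I j = CSITState.D) :
    ∀ᵐ g ∂chanMeasure k m n μ,
      (Matrix.fromRows (f.recvS S i g) (f.recvS S j g)).rank ≤ 2 * (f.recvS S j g).rank := by
  filter_upwards [ae_all_iff.2 (f.ae_forall_VS_mem_pastSpan μ S j hj)] with g hg
  refine rank_fromRows_le_two_mul _ _ fun t ht => ?_
  rw [recvS_row]
  exact Submodule.sum_mem _ fun a _ => Submodule.smul_mem _ _ (hg t ht a)

lemma dim_add_rank_le_rank_fromRows (f : Strategy k m n I) (S : Finset (Fin k)) (i j : Fin k)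
    (hi : i ∉ S) (g : Chan k m n)
    (h : (f.recvS Finset.univ i g).rank - (f.recvS (Finset.univ.erase i) i g).rank
        = (f.recv1 i g).rank ∧ (f.recv1 i g).rank = f.dim i) :
    f.dim i + (f.recvS S j g).rank ≤
      (Matrix.fromRows (f.recvS (insert i S) i g) (f.recvS (insert i S) j g)).rank := by
  obtain ⟨h1, h2⟩ := h
  rw [h2] at h1
  set H := (Matrix.fromRows (blockDiag (g i)) (blockDiag (g j))).mulVecLin with hH
  set pA : (Fin n ⊕ Fin n → ℂ) →ₗ[ℂ] (Fin n → ℂ) := LinearMap.funLeft ℂ ℂ Sum.inl with hpA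
  set pB : (Fin n ⊕ Fin n → ℂ) →ₗ[ℂ] (Fin n → ℂ) := LinearMap.funLeft ℂ ℂ Sum.inr with hpB
  have hA : pA ∘ₗ H = (blockDiag (g i)).mulVecLin := by
    refine LinearMap.ext fun x => funext fun t => ?_
    simp [hpA, hH, LinearMap.funLeft_apply, Matrix.fromRows_mulVec]
  have hB : pB ∘ₗ H = (blockDiag (g j)).mulVecLin := by
    refine LinearMap.ext fun x => funext fun t => ?_
    simp [hpB, hH, LinearMap.funLeft_apply, Matrix.fromRows_mulVec]
  have key := add_finrank_map_le H pA pB (⨆ l ∈ S, LinearMap.range (f.Vn l g).mulVecLin)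
    (⨆ l ∈ Finset.univ.erase i, LinearMap.range (f.Vn l g).mulVecLin)
    (LinearMap.range (f.Vn i g).mulVecLin)
    (biSup_mono fun l hl => Finset.mem_erase.2 ⟨fun e => hi (e ▸ hl), Finset.mem_univ l⟩)
    (f.dim i) ?_ ?_ ?_
  · rw [hB, ← rank_recvS] at key
    refine key.trans_eq ?_
    rw [sup_comm, ← Finset.iSup_insert i _ (fun l => LinearMap.range (f.Vn l g).mulVecLin), ← range_VS, ← LinearMap.range_comp, hH,
      ← Matrix.mulVecLin_mul, Matrix.fromRows_mul]
    rfl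
  · rw [hA, sup_comm, ← Finset.iSup_insert i _ (fun l => LinearMap.range (f.Vn l g).mulVecLin), Finset.insert_erase (Finset.mem_univ i),
      ← rank_recvS, ← rank_recvS, h1]
  · rw [hA, ← LinearMap.range_comp, ← Matrix.mulVecLin_mul]
    exact h2
  · exact (LinearMap.finrank_range_le _).trans (by simp)

lemma ae_dim_add_rank_le (f : Strategy k m n I) (μ : Measure ℂ) [IsProbabilityMeasure μ]
    [NullSingletonClass μ] (hdec : f.Decodable μ) (S : Finset (Fin k)) (i j : Fin k) (hi : i ∉ S)
    (hj : I j = CSITState.D) :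
    ∀ᵐ g ∂chanMeasure k m n μ,
      f.dim i + (f.recvS S j g).rank ≤ 2 * (f.recvS (insert i S) j g).rank := by
  filter_upwards [hdec i, f.ae_rank_fromRows_le μ (insert i S) i j hj] with g h1 h2
  exact (f.dim_add_rank_le_rank_fromRows S i j hi g h1).trans h2

end Strategy

/-- **Claim 1.** With `𝒫 = {1,…,p}`, `𝒟 = {p+1,…,p+dd}` (`dd ≥ 1`) and
`𝒩 = {p+dd+1,…,k}`, for every decodable linear coding strategy, almost surely
`∑_{j=1}^{p+dd-1} m_j(n)/2^j ≤ rank[G_{p+dd}^n [V_1^n … V_{p+dd-1}^n]]`. -/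
theorem claim_sum_dims_le_rank (k m n p dd : ℕ) (hkm : k ≤ m)
    (hdd : 1 ≤ dd) (hpd : p + dd ≤ k) (I : Fin k → CSITState)
    (hP : ∀ i : Fin k, (i : ℕ) < p → I i = CSITState.P)
    (hD : ∀ i : Fin k, p ≤ (i : ℕ) → (i : ℕ) < p + dd → I i = CSITState.D)
    (hN : ∀ i : Fin k, p + dd ≤ (i : ℕ) → I i = CSITState.N)
    (μ : Measure ℂ) [IsProbabilityMeasure μ] (hac : μ ≪ (volume : Measure ℂ))
    (f : Strategy k m n I) (hdec : f.Decodable μ) :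
    ∀ᵐ g ∂ chanMeasure k m n μ,
      ∑ j ∈ Finset.univ.filter (fun j : Fin k => (j : ℕ) < p + dd - 1),
          (f.dim j : ℝ) / 2 ^ ((j : ℕ) + 1)
        ≤ ((f.recvS (Finset.univ.filter fun i : Fin k => (i : ℕ) < p + dd - 1)
              ⟨p + dd - 1, by omega⟩ g).rank : ℝ) := by
  have : NullSingletonClass μ := ⟨fun x => hac (measure_singleton x)⟩
  have hlast : I ⟨p + dd - 1, by omega⟩ = CSITState.D :=
    hD _ (by simp only; omega) (by simp only; omega)
  let T : ℕ → Finset (Fin k) := fun q =>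
    Finset.univ.filter fun i : Fin k => q ≤ (i : ℕ) ∧ (i : ℕ) < p + dd - 1
  have hstep : ∀ i : Fin k, ∀ᵐ g ∂chanMeasure k m n μ, f.dim i +
      (f.recvS (T (i + 1)) ⟨p + dd - 1, by omega⟩ g).rank ≤
        2 * (f.recvS (insert i (T (i + 1))) ⟨p + dd - 1, by omega⟩ g).rank := fun i =>
    f.ae_dim_add_rank_le μ hdec _ i _ (by simp [T]) hlast
  filter_upwards [ae_all_iff.2 hstep] with g hg
  have key : ∀ q ≤ p + dd - 1,
      ∑ j ∈ Finset.univ.filter (fun j : Fin k => (j : ℕ) < q), (f.dim j : ℝ) / 2 ^ ((j : ℕ) + 1)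
        + ((f.recvS (T q) ⟨p + dd - 1, by omega⟩ g).rank : ℝ) / 2 ^ q
        ≤ ((f.recvS (T 0) ⟨p + dd - 1, by omega⟩ g).rank : ℝ) := by
    intro q
    induction q with
    | zero => simp
    | succ q ih =>
      intro hq
      have hqk : q < k := by omega
      have hsum : Finset.univ.filter (fun j : Fin k => (j : ℕ) < q + 1) =
          insert ⟨q, hqk⟩ (Finset.univ.filter fun j : Fin k => (j : ℕ) < q) := by
        ext s
        simp only [Finset.mem_filter_univ, Finset.mem_insert, Fin.ext_iff]
        omega
      have hT : insert ⟨q, hqk⟩ (T (q + 1)) = T q := by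
        ext s
        simp only [T, Finset.mem_filter_univ, Finset.mem_insert, Fin.ext_iff]
        omega
      have h := hg ⟨q, hqk⟩
      rw [hT] at h
      have h' : (f.dim ⟨q, hqk⟩ : ℝ) + (f.recvS (T (q + 1)) ⟨p + dd - 1, by omega⟩ g).rank ≤
          2 * (f.recvS (T q) ⟨p + dd - 1, by omega⟩ g).rank := by
        exact_mod_cast h
      rw [hsum, Finset.sum_insert (by simp)]
      refine le_trans ?_ (ih (by omega))
      have h2 := div_le_div_of_nonneg_right h' (by positivity : (0 : ℝ) ≤ 2 ^ (q + 1))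
      rw [add_div, pow_succ (2 : ℝ) q, mul_comm (2 : ℝ) (Matrix.rank _ : ℝ),
        mul_div_mul_right _ _ (two_ne_zero' ℝ)] at h2
      rw [pow_succ (2 : ℝ) q]
      linarith
  have hfin := key _ le_rfl
  have hT0 : T 0 = Finset.univ.filter fun i : Fin k => (i : ℕ) < p + dd - 1 := by
    simp [T]
  rw [hT0] at hfin
  refine le_trans ?_ hfin
  exact le_add_of_nonneg_right (by positivity)

end
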